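/- Let q ≥ 3 be a prime power, m ≥ 3 an integer, N = q^m - 1, and 0 ≤ ℓ ≤ m - 1. Then for every integer i with -(q^{m-1-ℓ} - 1) ≤ i ≤ 2(q^ℓ - 1)/(q-1) - 1, the integer j = (1 + (q-1)·i) mod N satisfies j ≡ 1 (mod q-1) and wt_q(j) ≠ 1 + (q-1)ℓ; that is, j lies in { h : 0 ≤ h ≤ N-1, h ≡ 1 (mod q-1) } but not in T_{(q,m,ℓ)}. -/

import Mathlib

/-- The `q`-weight of a natural number: the sum of its base-`q` digits. -/
def wtq (q i : ℕ) : ℕ := (Nat.digits q i).sum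

theorem wtq_mul_add {q : ℕ} (hq : 2 ≤ q) (a : ℕ) {b : ℕ} (hb : b < q) :
    wtq q (q * a + b) = b + wtq q a := by
  have hmod : (q * a + b) % q = b := by rw [Nat.mul_add_mod, Nat.mod_eq_of_lt hb]
  have hdiv : (q * a + b) / q = a := by
    rw [Nat.mul_add_div (by lia), Nat.div_eq_of_lt hb, add_zero]
  rcases Nat.eq_zero_or_pos (q * a + b) with h | h
  · rw [h] at hmod hdiv
    simp only [Nat.zero_mod, Nat.zero_div] at hmod hdiv
    subst hmod hdiv
    simp [wtq]
  · simp [wtq, Nat.digits_def' (by lia : 1 < q) h, hmod, hdiv]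

theorem wtq_of_lt {q n : ℕ} (hq : 2 ≤ q) (hn : n < q) : wtq q n = n := by
  have h := wtq_mul_add hq 0 hn
  simpa [wtq] using h

theorem wtq_le_of_lt_mul_pow {q c : ℕ} (hq : 2 ≤ q) (hc : c ≤ q) (s : ℕ) {n : ℕ}
    (hn : n < c * q ^ s) : wtq q n + 1 ≤ c + (q - 1) * s := by
  induction s generalizing n with
  | zero =>
    rw [pow_zero, mul_one] at hn
    rw [wtq_of_lt hq (by lia)]
    lia
  | succ s ih =>
    have hb : n % q < q := Nat.mod_lt _ (by lia)
    have ha : n / q < c * q ^ s := by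
      rw [Nat.div_lt_iff_lt_mul (by lia), mul_assoc, ← pow_succ]
      exact hn
    have hw := wtq_mul_add hq (n / q) hb
    rw [Nat.div_add_mod] at hw
    have := ih ha
    rw [mul_add, mul_one]
    lia

theorem wtq_lt_of_succ_lt_mul_pow {q c : ℕ} (hq : 2 ≤ q) (hc : c ≤ q) (s : ℕ) {n : ℕ}
    (hn : n + 1 < c * q ^ s) : wtq q n + 1 < c + (q - 1) * s := by
  induction s generalizing n with
  | zero =>
    rw [pow_zero, mul_one] at hn
    rw [wtq_of_lt hq (by lia)]
    lia
  | succ s ih =>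
    have hb : n % q < q := Nat.mod_lt _ (by lia)
    have hn' : n + 1 < c * q ^ s * q := by rwa [mul_assoc, ← pow_succ]
    have ha : n / q < c * q ^ s := by
      rw [Nat.div_lt_iff_lt_mul (by lia)]
      lia
    have hdm := Nat.div_add_mod n q
    have hw := wtq_mul_add hq (n / q) hb
    rw [hdm] at hw
    rw [mul_add, mul_one]
    rcases Nat.lt_or_ge (n / q + 1) (c * q ^ s) with h | h
    · have := ih h
      lia
    · have hle := wtq_le_of_lt_mul_pow hq hc s ha
      have heq : c * q ^ s = n / q + 1 := by lia
      rw [heq, add_mul, one_mul, mul_comm (n / q) q] at hn'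
      lia

theorem wtq_add_wtq_of_add_eq {q : ℕ} (hq : 2 ≤ q) (m : ℕ) {x y : ℕ}
    (h : x + y + 1 = q ^ m) : wtq q x + wtq q y = (q - 1) * m := by
  induction m generalizing x y with
  | zero =>
    obtain ⟨rfl, rfl⟩ : x = 0 ∧ y = 0 := by rw [pow_zero] at h; lia
    simp [wtq]
  | succ m ih =>
    have hb : x % q < q := Nat.mod_lt _ (by lia)
    have hxy : x / q < q ^ m := by
      rw [Nat.div_lt_iff_lt_mul (by lia), ← pow_succ]
      lia
    obtain ⟨z, hz⟩ : ∃ z, x / q + z + 1 = q ^ m := ⟨q ^ m - 1 - x / q, by lia⟩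
    have hdm := Nat.div_add_mod x q
    have hy : y = q * z + (q - 1 - x % q) := by
      rw [pow_succ, ← hz, add_mul, add_mul, one_mul, mul_comm _ q, mul_comm z q] at h
      lia
    have hwx := wtq_mul_add hq (x / q) hb
    rw [hdm] at hwx
    have hwy := wtq_mul_add hq z (by lia : q - 1 - x % q < q)
    rw [← hy] at hwy
    have := ih hz
    rw [mul_add, mul_one]
    lia


/-- Let `q ≥ 3` be a prime power, `m ≥ 3`, `N = q^m - 1` and
`0 ≤ ℓ ≤ m - 1`. Then for every integer `i` with
`-(q^{m-1-ℓ} - 1) ≤ i ≤ 2(q^ℓ - 1)/(q-1) - 1`, the integer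
`j = (1 + (q-1)·i) mod N` satisfies `j ≡ 1 (mod q-1)` and
`wt_q(j) ≠ 1 + (q-1)ℓ`; that is, `j` lies in
`{ h : 0 ≤ h ≤ N-1, h ≡ 1 (mod q-1) }` but not in `T_{(q,m,ℓ)}`. -/
theorem stmt16 (q m l : ℕ) (hq : 3 ≤ q) (hpp : IsPrimePow q) (hm : 3 ≤ m)
    (hl : l ≤ m - 1) (N : ℤ) (hN : N = (q : ℤ) ^ m - 1)
    (i : ℤ) (hi1 : -((q : ℤ) ^ (m - 1 - l) - 1) ≤ i)
    (hi2 : i ≤ 2 * (((q : ℤ) ^ l - 1) / ((q : ℤ) - 1)) - 1) :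
    ∀ j : ℤ, j = (1 + ((q : ℤ) - 1) * i) % N →
      j % ((q : ℤ) - 1) = 1 ∧ wtq q j.toNat ≠ 1 + (q - 1) * l := by
  intro j hj
  have hqz : (3 : ℤ) ≤ q := by exact_mod_cast hq
  have hdvd (k : ℕ) : (q : ℤ) - 1 ∣ (q : ℤ) ^ k - 1 := sub_one_dvd_pow_sub_one _ k
  refine ⟨?_, ?_⟩
  · rw [hj, Int.emod_emod_of_dvd _ (hN ▸ hdvd m), Int.add_mul_emod_self_left]
    exact Int.emod_eq_of_lt (by lia) (by lia)
  have hqpos : (0 : ℤ) < q := by lia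
  rcases le_or_gt 0 i with hi | hi
  · have hS : ((q : ℤ) - 1) * (((q : ℤ) ^ l - 1) / ((q : ℤ) - 1)) = (q : ℤ) ^ l - 1 :=
      Int.mul_ediv_cancel' (hdvd l)
    have hpow : (q : ℤ) ^ l * q ≤ (q : ℤ) ^ m := by
      rw [← pow_succ]
      exact pow_le_pow_right₀ (by lia) (by lia)
    have hle : 1 + ((q : ℤ) - 1) * i ≤ 2 * (q : ℤ) ^ l - q := by
      nlinarith [mul_le_mul_of_nonneg_left hi2 (by lia : (0 : ℤ) ≤ (q : ℤ) - 1)]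
    have hnn : 0 ≤ ((q : ℤ) - 1) * i := mul_nonneg (by lia) hi
    have hlpos : 0 < (q : ℤ) ^ l := by positivity
    rw [Int.emod_eq_of_lt (by lia) (by nlinarith)] at hj
    have hlt : j.toNat + 1 < 2 * q ^ l := by
      zify
      rw [Int.toNat_of_nonneg (by lia)]
      lia
    have := wtq_lt_of_succ_lt_mul_pow (by lia) (by lia) l hlt
    lia
  · obtain ⟨s, rfl⟩ : ∃ s, m = l + s + 1 := ⟨m - 1 - l, by lia⟩
    rw [show l + s + 1 - 1 - l = s by lia] at hi1
    have hle : -(((q : ℤ) - 1) * i) ≤ (q - 1) * (q : ℤ) ^ s - (q - 1) := by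
      nlinarith
    have hge : (q : ℤ) - 1 ≤ -(((q : ℤ) - 1) * i) := by nlinarith
    have hpow : (q : ℤ) ^ s * q ≤ (q : ℤ) ^ (l + s + 1) := by
      rw [← pow_succ]
      exact pow_le_pow_right₀ (by lia) (by lia)
    have hspos : 0 < (q : ℤ) ^ s := by positivity
    rw [← Int.add_emod_right, Int.emod_eq_of_lt (by nlinarith) (by lia)] at hj
    have hj0 : 0 ≤ j := by nlinarith
    obtain ⟨x, hx⟩ : ∃ x : ℕ, (x : ℤ) = -(((q : ℤ) - 1) * i) - 1 :=
      ⟨(-(((q : ℤ) - 1) * i) - 1).toNat, Int.toNat_of_nonneg (by lia)⟩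
    have hsum : x + j.toNat + 1 = q ^ (l + s + 1) := by
      zify
      rw [Int.toNat_of_nonneg hj0]
      lia
    have hlt : x + 1 < (q - 1) * q ^ s := by
      zify [(by lia : 1 ≤ q)]
      lia
    have h1 := wtq_lt_of_succ_lt_mul_pow (by lia) (by lia) s hlt
    have h2 := wtq_add_wtq_of_add_eq (by lia) _ hsum
    rw [mul_add, mul_add, mul_one] at h2
    lia
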